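/- Let kₙ(x) := ⌊n!/2 + x·√(n!/4)⌋ for x ∈ ℝ. For any real numbers x and y, the limit as n → ∞ of T(n, kₙ(x))² / (T(n, kₙ(x+y)) · T(n, kₙ(x−y))) equals exp(y²). In particular this limit is at least 1, so T(n, kₙ(·)) is asymptotically log-concave in the bulk. -/

import Mathlib

open Equiv Finset

/-- Two `k`-subsets of `Sₙ` are equivalent if one is obtained from the other by
two-sided multiplication `σ ↦ g₁ * σ * g₂` for some pair `(g₁, g₂)`. -/
def permSetRel (n k : ℕ) (x y : {s : Finset (Perm (Fin n)) // s.card = k}) : Prop :=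
  ∃ g₁ g₂ : Perm (Fin n),
    (x : Finset (Perm (Fin n))).image (fun σ => g₁ * σ * g₂) = (y : Finset (Perm (Fin n)))

/-- `T n k` is the number of orbits of the action of `Sₙ × Sₙ` on the family of
`k`-element subsets of `Sₙ`. -/
noncomputable def T (n k : ℕ) : ℕ := Nat.card (Quot (permSetRel n k))

/-- `kₙ(x) = ⌊n!/2 + x·√(n!/4)⌋`. -/
noncomputable def kIdx (n : ℕ) (x : ℝ) : ℤ :=
  ⌊(n.factorial : ℝ) / 2 + x * Real.sqrt ((n.factorial : ℝ) / 4)⌋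

/-- `T(n,k)` extended to integer `k`, with value `0` for `k < 0` (and automatically `0`
for `k > n!`, since there are no `k`-subsets of `Sₙ`). -/
noncomputable def Tz (n : ℕ) (k : ℤ) : ℕ := if 0 ≤ k then T n k.toNat else 0

section Aux

open Filter Topology

lemma hbound (u : ℝ) (hu : |u| ≤ 1/2) :
    |(1+u)*Real.log (1+u) + (1-u)*Real.log (1-u) - u^2| ≤ 8*|u|^3 := by
  have h1 := Real.abs_log_sub_add_sum_range_le (x := u) (by linarith) 2
  have h2 := Real.abs_log_sub_add_sum_range_le (x := -u) (by rw [abs_neg]; linarith) 2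
  rw [abs_neg] at h2
  simp only [Finset.sum_range_succ, Finset.sum_range_zero] at h1 h2
  have h3 : |u|^(2+1)/(1-|u|) ≤ 2*|u|^3 := by
    rw [div_le_iff₀ (by linarith)]
    have : 0 ≤ |u|^3 := by positivity
    norm_num
    nlinarith
  replace h1 := h1.trans h3
  replace h2 := h2.trans h3
  rw [sub_neg_eq_add] at h2
  norm_num at h1 h2
  set a := Real.log (1+u)
  set b := Real.log (1-u)
  have e : (1+u)*a + (1-u)*b - u^2 = (1+u)*(-u + u^2/2 + a) + (1-u)*(u+u^2/2+b) := by ring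
  rw [e]
  have hb := abs_le.1 hu
  calc _ ≤ |(1+u)*(-u + u^2/2 + a)| + |(1-u)*(u+u^2/2+b)| := abs_add_le _ _
    _ = (1+u) * |(-u + u^2/2 + a)| + (1-u)*|(u+u^2/2+b)| := by
        rw [abs_mul, abs_mul, abs_of_nonneg (by linarith : 0 ≤ 1+u), abs_of_nonneg (by linarith : 0 ≤ 1-u)]
    _ ≤ (1+u) * (2*|u|^3) + (1-u)*(2*|u|^3) := by gcongr <;> linarith
    _ ≤ _ := by have : 0 ≤ |u|^3 := by positivity
                nlinarith

noncomputable def Stir (m : ℕ) : ℝ := √(2*m*Real.pi) * (m/Real.exp 1)^m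

lemma stir_tendsto : Tendsto (fun m : ℕ => (m.factorial : ℝ)/Stir m) atTop (𝓝 1) := by
  have := Stirling.factorial_isEquivalent_stirling
  refine (Asymptotics.isEquivalent_iff_tendsto_one ?_).1 this
  filter_upwards [eventually_gt_atTop 0] with m hm
  have := Real.pi_pos
  have h : (0:ℝ) < m := by exact_mod_cast hm
  have : 0 < √(2*m*Real.pi) * (m/Real.exp 1)^m := by positivity
  exact this.ne'

lemma stir_exp (m : ℕ) (hm : 0 < m) : Stir m = √(2*m*Real.pi) * Real.exp (m * Real.log m - m) := by
  have h : (0:ℝ) < m := by exact_mod_cast hm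
  unfold Stir
  congr 1
  rw [← Real.rpow_natCast, Real.rpow_def_of_pos (by positivity), Real.log_div (by positivity) (by positivity), Real.log_exp]
  ring_nf

lemma stir_ratio (N k : ℕ) (hk : 0 < k) (hkN : k < N) (u : ℝ) (hu : u = (2*k - N)/N) :
    Stir N * √N / (2^N * (Stir k * Stir (N-k))) =
     √(2/(Real.pi * (1-u^2))) * Real.exp (-(N/2*((1+u)*Real.log (1+u) + (1-u)*Real.log (1-u)))) := by
  have h : (0:ℝ) < k := by exact_mod_cast hk
  have h1 : (k:ℝ) < N := by exact_mod_cast hkN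
  have h2 : (0:ℝ) < N := by linarith
  rw [stir_exp N (by omega), stir_exp k hk, stir_exp (N-k) (by omega), Nat.cast_sub hkN.le]
  have ek : (k:ℝ) = N/2*(1+u) := by rw [hu]; field_simp; ring
  have eNk : (N:ℝ) - k = N/2*(1-u) := by rw [hu]; field_simp; ring
  have p1 : 0 < 1+u := by
    by_contra! hh
    nlinarith
  have p2 : 0 < 1-u := by
    by_contra! hh
    nlinarith
  have p3 : 0 < 1 - u^2 := by nlinarith
  have e2 : (2:ℝ)^N = Real.exp (N * Real.log 2) := by
    rw [← Real.rpow_natCast, Real.rpow_def_of_pos (by norm_num)]; ring_nf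
  have E : Real.exp (N * Real.log N - N) / (2^N * (Real.exp (k * Real.log k - k) * Real.exp (((N:ℝ)-k) * Real.log ((N:ℝ)-k) - ((N:ℝ)-k)))) = Real.exp (-(N/2*((1+u)*Real.log (1+u) + (1-u)*Real.log (1-u)))) := by
    rw [e2, ← Real.exp_add, ← Real.exp_add, ← Real.exp_sub, eNk, ek, Real.log_mul (by positivity) p1.ne', Real.log_mul (by positivity) p2.ne', Real.log_div (by positivity) (by norm_num)]
    congr 1
    ring
  have S : √(2*N*Real.pi) * √N / (√(2*k*Real.pi) * √(2*((N:ℝ)-k)*Real.pi)) = √(2/(Real.pi * (1-u^2))) := by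
    rw [← Real.sqrt_mul (by positivity), ← Real.sqrt_mul (by positivity), ← Real.sqrt_div (by positivity), eNk, ek]
    congr 1
    have := Real.pi_pos
    have : (1 - u^2) = (1+u)*(1-u) := by ring
    rw [this]
    field_simp
  rw [← E, ← S]
  ring

lemma binom_asymp (N k : ℕ → ℕ) (hN : Tendsto N atTop atTop) (x : ℝ)
    (hk : Tendsto (fun n => (2*(k n : ℝ) - N n)/√(N n)) atTop (𝓝 x)) :
    Tendsto (fun n => ((N n).choose (k n) : ℝ) * √(N n)/2^(N n)) atTop
      (𝓝 (√(2/Real.pi) * Real.exp (-(x^2/2)))) := by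
  have hNR : Tendsto (fun n => (N n : ℝ)) atTop atTop := tendsto_natCast_atTop_atTop.comp hN
  have hsq : Tendsto (fun n => √(N n : ℝ)) atTop atTop := Real.tendsto_sqrt_atTop.comp hNR
  set v : ℕ → ℝ := fun n => (2*(k n : ℝ) - N n)/√(N n) with hv
  set u : ℕ → ℝ := fun n => (2*(k n : ℝ) - N n)/(N n) with hu
  have huv : ∀ n, u n = v n / √(N n) := by
    intro n
    simp only [hu, hv]
    rw [div_div, Real.mul_self_sqrt (by positivity)]
  have hu0 : Tendsto u atTop (𝓝 0) := by
    rw [funext huv]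
    exact hk.div_atTop hsq
  have hu1 : ∀ᶠ n in atTop, |u n| ≤ 1/2 := by
    have := hu0.abs
    rw [abs_zero] at this
    exact this.eventually (eventually_le_nhds (by norm_num))
  have hNpos : ∀ᶠ n in atTop, 1 ≤ N n := hN.eventually (eventually_ge_atTop 1)
  have hb : ∀ᶠ n in atTop, (N n : ℝ)/4 ≤ k n ∧ (N n : ℝ)/4 ≤ (N n : ℝ) - k n := by
    filter_upwards [hu1, hNpos] with n h1 h2
    have h3 : (0:ℝ) < N n := by exact_mod_cast h2
    have h4 : u n * N n = 2*(k n : ℝ) - N n := by simp only [hu]; field_simp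
    have := abs_le.1 h1
    constructor <;> nlinarith
  have hlt : ∀ᶠ n in atTop, 0 < k n ∧ k n < N n := by
    filter_upwards [hb, hNpos] with n h1 h2
    have h3 : (0:ℝ) < N n := by exact_mod_cast h2
    have h4 : (0:ℝ) < k n := by linarith
    have h5 : (k n : ℝ) < N n := by linarith
    exact ⟨by exact_mod_cast h4, by exact_mod_cast h5⟩
  have hN4 : Tendsto (fun n => (N n : ℝ)/4) atTop atTop := hNR.atTop_div_const (by norm_num)
  have hkT : Tendsto k atTop atTop := by
    apply tendsto_natCast_atTop_iff (R := ℝ).1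
    exact tendsto_atTop_mono' _ (hb.mono fun n h => h.1) hN4
  have hkT' : Tendsto (fun n => N n - k n) atTop atTop := by
    apply tendsto_natCast_atTop_iff (R := ℝ).1
    refine tendsto_atTop_mono' _ ?_ hN4
    filter_upwards [hb, hlt] with n h h'
    rw [Nat.cast_sub h'.2.le]
    exact h.2
  have r1 := stir_tendsto.comp hN
  have r2 := stir_tendsto.comp hkT
  have r3 := stir_tendsto.comp hkT'
  have hr := r1.div (r2.mul r3) (by norm_num)
  have hs : Tendsto (fun n => √(2/(Real.pi * (1-(u n)^2)))) atTop (𝓝 (√(2/Real.pi))) := by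
    have : Tendsto (fun n => √(2/(Real.pi * (1-(u n)^2)))) atTop (𝓝 (√(2/(Real.pi * (1-0^2))))) := by
      apply Tendsto.sqrt
      apply Tendsto.div tendsto_const_nhds
      · exact tendsto_const_nhds.mul (tendsto_const_nhds.sub (hu0.pow 2))
      · simp [Real.pi_ne_zero]
    simpa using this
  have he : Tendsto (fun n => (N n : ℝ)/2*((1+u n)*Real.log (1+u n) + (1-u n)*Real.log (1-u n))) atTop (𝓝 (x^2/2)) := by
    have hz : Tendsto (fun n => (N n : ℝ)/2*((1+u n)*Real.log (1+u n) + (1-u n)*Real.log (1-u n)) - (v n)^2/2) atTop (𝓝 0) := by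
      have hz1 : Tendsto (fun n => 4 * |v n|^3 / √(N n)) atTop (𝓝 0) :=
        ((hk.abs.pow 3).const_mul 4).div_atTop hsq
      apply squeeze_zero_norm' _ hz1
      filter_upwards [hu1, hNpos] with n h1 h2
      have h3 : (0:ℝ) < N n := by exact_mod_cast h2
      have h4 := hbound (u n) h1
      have hs0 : 0 < √(N n : ℝ) := Real.sqrt_pos.2 h3
      have hs2 : √(N n : ℝ)^2 = N n := Real.sq_sqrt h3.le
      have e1 : (v n)^2/2 = (N n : ℝ)/2 * (u n)^2 := by
        rw [huv]; field_simp; rw [hs2]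
      rw [e1, ← mul_sub, Real.norm_eq_abs, abs_mul, abs_of_pos (by positivity)]
      calc _ ≤ (N n : ℝ)/2 * (8 * |u n|^3) := by gcongr
        _ = _ := by
          rw [huv, abs_div, abs_of_pos hs0]; field_simp; rw [hs2]; ring
    have := hz.add ((hk.pow 2).div_const 2)
    simpa using this
  have := hr.mul (hs.mul ((Real.continuous_exp.tendsto _).comp he.neg))
  simp only [mul_one, div_one, one_mul] at this
  refine this.congr' ?_
  filter_upwards [hlt] with n h
  have hc : ((N n).choose (k n) : ℝ) = (N n).factorial / ((k n).factorial * (N n - k n).factorial) := by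
    exact Nat.cast_choose ℝ h.2.le
  have hS := stir_ratio (N n) (k n) h.1 h.2 (u n) rfl
  simp only [Function.comp, Pi.div_apply]
  rw [← hS, hc]
  have pos : ∀ m : ℕ, 0 < m → 0 < Stir m := by
    intro m hm
    rw [stir_exp m hm]
    have := Real.pi_pos
    positivity
  have q1 := pos (N n) (by omega)
  have q2 := pos (k n) (by omega)
  have q3 := pos (N n - k n) (by omega)
  have f1 : ((k n).factorial : ℝ) ≠ 0 := by positivity
  have f2 : ((N n - k n).factorial : ℝ) ≠ 0 := by positivity
  field_simp

/-- finsets fixed by a permutation moving many points -/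
lemma card_fixed_sets {α : Type*} [Fintype α] [DecidableEq α] (f : Perm α)
    (F : Finset (Finset α)) (hF : ∀ s ∈ F, s.image f = s) (m : ℕ)
    (hm : 6 * m ≤ Fintype.card α)
    (hf : 2 * (univ.filter (fun a => f a = a)).card ≤ Fintype.card α) :
    F.card ≤ 2 ^ (Fintype.card α - m) := by
  classical
  obtain ⟨A, hA, hmax⟩ := Finset.exists_max_image
    (univ.filter (fun A : Finset α => ∀ a ∈ A, f a ∉ A)) Finset.card ⟨∅, by simp⟩
  simp only [Finset.mem_filter, Finset.mem_univ, true_and] at hA hmax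
  have hcov : (univ : Finset α) ⊆ (univ.filter (fun a => f a = a)) ∪ (A ∪ A.image f ∪ A.image f.symm) := by
    intro x _
    by_contra hx
    simp only [mem_union, mem_filter, mem_univ, true_and, mem_image, not_or, not_exists, not_and] at hx
    obtain ⟨h1, ⟨h2, h3⟩, h4⟩ := hx
    have := hmax (insert x A) (by
      intro a ha
      rw [mem_insert] at ha ⊢
      rcases ha with rfl | ha
      · rintro (h | h)
        · exact h1 h
        · exact h4 _ h (by simp)
      · rintro (h | h)
        · exact h3 a ha h
        · exact hA a ha h)
    rw [card_insert_of_notMem h2] at this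
    omega
  have hc := card_le_card hcov
  have c1 := card_union_le (univ.filter (fun a => f a = a)) (A ∪ A.image f ∪ A.image f.symm)
  have c2 := card_union_le (A ∪ A.image f) (A.image f.symm)
  have c3 := card_union_le A (A.image f)
  have c4 := card_image_le (s := A) (f := f)
  have c5 := card_image_le (s := A) (f := f.symm)
  rw [card_univ] at hc
  have hmA : m ≤ A.card := by omega
  have key : F.card ≤ (Aᶜ.powerset).card := by
    refine Finset.card_le_card_of_injOn (fun s => s ∩ Aᶜ) ?_ ?_
    · intro s _
      simp
    · intro s hs t ht hst
      simp only at hst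
      have iff1 : ∀ u : Finset α, u.image f = u → ∀ a, a ∈ u ↔ f a ∈ u := by
        intro u hu a
        conv_rhs => rw [← hu]
        simp
      have hst' : ∀ a, a ∉ A → (a ∈ s ↔ a ∈ t) := by
        intro a ha
        have := congrArg (a ∈ ·) hst
        simpa [ha] using this
      ext a
      by_cases ha : a ∈ A
      · rw [iff1 s (hF s hs), iff1 t (hF t ht)]
        exact hst' _ (hA a ha)
      · exact hst' a ha
  rw [card_powerset, card_compl] at key
  exact key.trans (Nat.pow_le_pow_right (by norm_num) (by omega))

lemma fix_half (n : ℕ) (hn : 3 ≤ n) (g h : Perm (Fin n)) (hgh : (g, h) ≠ 1) :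
    2 * (univ.filter (fun σ : Perm (Fin n) => g * σ * h = σ)).card ≤ Fintype.card (Perm (Fin n)) := by
  classical
  by_cases hg : g = 1
  · have : (univ.filter (fun σ : Perm (Fin n) => g * σ * h = σ)) = ∅ := by
      rw [Finset.filter_eq_empty_iff]
      intro σ _ hs
      subst hg
      apply hgh
      simp at hs
      simp [hs]
    rw [this]; simp
  · have : ∃ τ : Perm (Fin n), g * τ ≠ τ * g := by
      by_contra! hc
      apply hg
      ext a : 1
      by_contra hab
      simp only [Equiv.Perm.one_apply] at hab
      obtain ⟨c, hc'⟩ : ∃ c, c ∉ ({a, g a} : Finset (Fin n)) := by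
        apply Finset.exists_mem_notMem_of_card_lt_card (s := {a, g a}) (t := univ) _ |>.imp
        · intro c hc; exact hc.2
        · have := Finset.card_le_two (a := a) (b := g a)
          rw [card_univ, Fintype.card_fin]
          omega
      simp only [mem_insert, mem_singleton, not_or] at hc'
      have h1 := congrArg (fun f : Perm (Fin n) => f a) (hc (swap (g a) c))
      simp only [Equiv.Perm.mul_apply] at h1
      rw [swap_apply_of_ne_of_ne (Ne.symm hab) (Ne.symm hc'.1), swap_apply_left] at h1
      exact hc'.2 h1.symm
    obtain ⟨τ, hτ⟩ := this
    have h1 : (univ.filter (fun σ : Perm (Fin n) => g * σ * h = σ)).card ≤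
        (univ.filter (fun σ : Perm (Fin n) => ¬ g * σ * h = σ)).card := by
      refine Finset.card_le_card_of_injOn (fun σ => τ * σ) ?_ ?_
      · intro σ hs
        simp only [coe_filter, mem_univ, true_and, Set.mem_ofPred_eq] at hs ⊢
        intro hh
        apply hτ
        have e : σ * h = g⁻¹ * σ := by
          rw [eq_inv_mul_iff_mul_eq, ← mul_assoc]; exact hs
        have : g * τ * (σ * h) = τ * σ := by rw [← hh]; group
        rw [e] at this
        have h2 : (g * τ * g⁻¹) * σ = τ * σ := by rw [← this]; group
        have h3 := mul_right_cancel h2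
        conv_rhs => rw [← h3]
        group
      · intro a _ b _ hab
        exact mul_left_cancel hab
    have h2 := Finset.card_filter_add_card_filter_not (s := (univ : Finset (Perm (Fin n)))) (fun σ : Perm (Fin n) => g * σ * h = σ)
    rw [card_univ] at h2
    omega

/-- two-sided translation as a permutation -/
def tr (n : ℕ) (p : Perm (Fin n) × Perm (Fin n)) : Perm (Perm (Fin n)) where
  toFun σ := p.1 * σ * p.2⁻¹
  invFun σ := p.1⁻¹ * σ * p.2
  left_inv σ := by group
  right_inv σ := by group

@[reducible] def act (n k : ℕ) : MulAction (Perm (Fin n) × Perm (Fin n)) {s : Finset (Perm (Fin n)) // s.card = k} where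
  smul p s := ⟨s.1.image (tr n p), by rw [card_image_of_injective _ (tr n p).injective, s.2]⟩
  one_smul s := by
    apply Subtype.ext
    change s.1.image (tr n 1) = s.1
    have : (tr n 1 : Perm (Fin n) → Perm (Fin n)) = id := by funext σ; simp [tr]
    rw [this, image_id]
  mul_smul p q s := by
    apply Subtype.ext
    change s.1.image (tr n (p * q)) = (s.1.image (tr n q)).image (tr n p)
    rw [image_image]
    congr 1

lemma T_bounds (n k : ℕ) (hn : 3 ≤ n) (m : ℕ) (hm : 6 * m ≤ n.factorial) :
    n.factorial.choose k ≤ T n k * n.factorial ^ 2 ∧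
    T n k * n.factorial ^ 2 ≤ n.factorial.choose k + n.factorial ^ 2 * 2 ^ (n.factorial - m) := by
  classical
  let _ := act n k
  have hcard : Fintype.card (Perm (Fin n)) = n.factorial := by
    rw [Fintype.card_perm, Fintype.card_fin]
  have hT : T n k = Fintype.card (Quotient (MulAction.orbitRel (Perm (Fin n) × Perm (Fin n)) {s : Finset (Perm (Fin n)) // s.card = k})) := by
    rw [← Nat.card_eq_fintype_card]
    unfold T
    apply Nat.card_congr
    refine Quot.congrRight ?_
    intro x y
    rw [← Setoid.comm', MulAction.orbitRel_apply]
    constructor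
    · rintro ⟨g, h, hh⟩
      refine ⟨(g, h⁻¹), ?_⟩
      apply Subtype.ext
      rw [← hh]
      change x.1.image (tr n (g, h⁻¹)) = _
      simp [tr]
    · rintro ⟨⟨g, h⟩, hh⟩
      refine ⟨g, h⁻¹, ?_⟩
      rw [← hh]
      rfl
  have hB := MulAction.sum_card_fixedBy_eq_card_orbits_mul_card_group (Perm (Fin n) × Perm (Fin n)) {s : Finset (Perm (Fin n)) // s.card = k}
  rw [← hT, Fintype.card_prod, hcard, ← pow_two] at hB
  rw [← hB, ← Finset.add_sum_erase _ _ (mem_univ (1 : Perm (Fin n) × Perm (Fin n)))]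
  have h1 : Fintype.card (MulAction.fixedBy {s : Finset (Perm (Fin n)) // s.card = k} (1 : Perm (Fin n) × Perm (Fin n))) = n.factorial.choose k := by
    rw [← hcard, ← Fintype.card_finset_len]
    apply Fintype.card_congr
    exact (Equiv.setCongr (MulAction.fixedBy_one_eq_univ _ _)).trans (Equiv.Set.univ _)
  rw [h1]
  refine ⟨Nat.le_add_right _ _, Nat.add_le_add_left ?_ _⟩
  have h2 : ∀ p ∈ (univ : Finset (Perm (Fin n) × Perm (Fin n))).erase 1,
      Fintype.card (MulAction.fixedBy {s : Finset (Perm (Fin n)) // s.card = k} p) ≤ 2 ^ (n.factorial - m) := by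
    intro p hp
    have hp1 := (mem_erase.1 hp).1
    rw [← hcard]
    have := card_fixed_sets (tr n p) (univ.filter (fun s => s.image (tr n p) = s)) (by simp) m (by rw [hcard]; exact hm)
      (fix_half n hn p.1 p.2⁻¹ (by
        intro h
        apply hp1
        simpa [Prod.ext_iff] using h))
    refine le_trans ?_ this
    rw [← Fintype.card_coe]
    refine Fintype.card_le_of_injective (fun s => ⟨s.1.1, ?_⟩) ?_
    · simp only [mem_filter, mem_univ, true_and]
      exact congrArg Subtype.val s.2
    · intro s t hst
      apply Subtype.ext
      apply Subtype.ext
      simpa using hst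
  refine (Finset.sum_le_card_nsmul _ _ _ h2).trans ?_
  rw [smul_eq_mul]
  gcongr
  refine (card_le_univ _).trans ?_
  rw [Fintype.card_prod, hcard, pow_two]

lemma kIdx_tendsto (x : ℝ) :
    Tendsto (fun n : ℕ => (2 * (kIdx n x : ℝ) - (n.factorial : ℝ)) / √(n.factorial : ℝ)) atTop (𝓝 x) := by
  have hN : Tendsto (fun n : ℕ => (n.factorial : ℝ)) atTop atTop :=
    tendsto_natCast_atTop_atTop.comp factorial_tendsto_atTop
  have hsq : Tendsto (fun n : ℕ => √(n.factorial : ℝ)) atTop atTop := Real.tendsto_sqrt_atTop.comp hN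
  have h0 : Tendsto (fun n : ℕ => 2 / √(n.factorial : ℝ)) atTop (𝓝 0) :=
    tendsto_const_nhds.div_atTop hsq
  have hz : Tendsto (fun n : ℕ => (2 * (kIdx n x : ℝ) - (n.factorial : ℝ)) / √(n.factorial : ℝ) - x) atTop (𝓝 0) := by
    apply squeeze_zero_norm _ h0
    intro n
    have hp : (0:ℝ) < n.factorial := by positivity
    have hs : 0 < √(n.factorial : ℝ) := Real.sqrt_pos.2 hp
    have h4 : √((n.factorial : ℝ) / 4) = √(n.factorial : ℝ) / 2 := by
      rw [Real.sqrt_div hp.le, show (4:ℝ) = 2 ^ 2 by norm_num, Real.sqrt_sq (by norm_num)]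
    have l1 := Int.floor_le ((n.factorial : ℝ) / 2 + x * √((n.factorial : ℝ) / 4))
    have l2 := Int.lt_floor_add_one ((n.factorial : ℝ) / 2 + x * √((n.factorial : ℝ) / 4))
    change (kIdx n x : ℝ) ≤ _ at l1
    change _ < (kIdx n x : ℝ) + 1 at l2
    rw [h4] at l1 l2
    rw [div_sub' hs.ne', Real.norm_eq_abs, abs_div, abs_of_pos hs]
    gcongr
    rw [abs_le]
    constructor <;> linarith
  simpa using hz.add_const x

lemma err_tendsto : Tendsto (fun n : ℕ => (n.factorial : ℝ) ^ 2 * 2 ^ (n.factorial - n.factorial / 6) *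
    (√(n.factorial : ℝ) / 2 ^ n.factorial)) atTop (𝓝 0) := by
  have hm : Tendsto (fun n : ℕ => n.factorial / 6) atTop atTop :=
    (Nat.tendsto_div_const_atTop (by norm_num)).comp factorial_tendsto_atTop
  have h1 := ((tendsto_pow_const_div_const_pow_of_one_lt 3 (r := (2:ℝ)) (by norm_num)).comp hm).const_mul 1331
  rw [mul_zero] at h1
  refine squeeze_zero' (Eventually.of_forall fun n => by positivity) ?_ h1
  filter_upwards [hm.eventually (eventually_ge_atTop 1)] with n hn
  simp only [Function.comp]
  set N := n.factorial
  set m := N / 6 with hmdef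
  have hNm : N ≤ 11 * m := by omega
  have hNm' : (N : ℝ) ≤ 11 * m := by exact_mod_cast hNm
  have hN1 : (1:ℝ) ≤ N := by
    have : 1 ≤ N := by omega
    exact_mod_cast this
  have e : (2:ℝ) ^ N = 2 ^ (N - m) * 2 ^ m := by
    rw [← pow_add]; congr 1; omega
  have hs : √(N : ℝ) ≤ N := by
    rw [Real.sqrt_le_left (by linarith)]; nlinarith
  rw [e]
  calc (N : ℝ) ^ 2 * 2 ^ (N - m) * (√(N : ℝ) / (2 ^ (N - m) * 2 ^ m)) = (N : ℝ) ^ 2 * √(N : ℝ) / 2 ^ m := by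
        field_simp
    _ ≤ (N : ℝ) ^ 2 * N / 2 ^ m := by gcongr
    _ = (N : ℝ) ^ 3 / 2 ^ m := by ring
    _ ≤ (11 * m : ℝ) ^ 3 / 2 ^ m := by gcongr
    _ = _ := by ring

lemma T_asymp (x : ℝ) :
    Tendsto (fun n : ℕ => (Tz n (kIdx n x) : ℝ) * ((n.factorial : ℝ) ^ 2 * (√(n.factorial : ℝ) / 2 ^ n.factorial)))
      atTop (𝓝 (√(2/Real.pi) * Real.exp (-(x^2/2)))) := by
  have hk := kIdx_tendsto x
  have hN : Tendsto (fun n : ℕ => (n.factorial : ℝ)) atTop atTop :=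
    tendsto_natCast_atTop_atTop.comp factorial_tendsto_atTop
  have hsq : Tendsto (fun n : ℕ => √(n.factorial : ℝ)) atTop atTop := Real.tendsto_sqrt_atTop.comp hN
  have hpos : ∀ᶠ n : ℕ in atTop, 0 ≤ kIdx n x := by
    filter_upwards [hk.eventually (eventually_ge_nhds (show x - 1 < x by linarith)),
      hsq.eventually (eventually_ge_atTop (1 - x))] with n h1 h2
    have hp : (0:ℝ) < n.factorial := by positivity
    have hs : 0 < √(n.factorial : ℝ) := Real.sqrt_pos.2 hp
    have hs2 : √(n.factorial : ℝ) * √(n.factorial : ℝ) = n.factorial := Real.mul_self_sqrt hp.le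
    rw [le_div_iff₀ hs] at h1
    have : (0:ℝ) ≤ kIdx n x := by nlinarith
    exact_mod_cast this
  have hb := binom_asymp (fun n => n.factorial) (fun n => (kIdx n x).toNat) factorial_tendsto_atTop x (by
    refine hk.congr' ?_
    filter_upwards [hpos] with n h
    have : ((kIdx n x).toNat : ℝ) = (kIdx n x : ℝ) := by
      exact_mod_cast congrArg (Int.cast (R := ℝ)) (Int.toNat_of_nonneg h)
    rw [this])
  have hup := hb.add err_tendsto
  rw [add_zero] at hup
  refine tendsto_of_tendsto_of_tendsto_of_le_of_le' hb hup ?_ ?_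
  · filter_upwards [hpos, eventually_ge_atTop 3] with n h h3
    have := (T_bounds n (kIdx n x).toNat h3 (n.factorial / 6) (by omega)).1
    have h' : ((n.factorial.choose (kIdx n x).toNat : ℕ) : ℝ) ≤ (T n (kIdx n x).toNat : ℝ) * (n.factorial : ℝ) ^ 2 := by
      exact_mod_cast this
    rw [Tz, if_pos h, ← mul_assoc, mul_div_assoc]
    gcongr
  · filter_upwards [hpos, eventually_ge_atTop 3] with n h h3
    have := (T_bounds n (kIdx n x).toNat h3 (n.factorial / 6) (by omega)).2
    have h' : (T n (kIdx n x).toNat : ℝ) * (n.factorial : ℝ) ^ 2 ≤ ((n.factorial.choose (kIdx n x).toNat : ℕ) : ℝ) + (n.factorial : ℝ) ^ 2 * 2 ^ (n.factorial - n.factorial / 6) := by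
      exact_mod_cast this
    rw [Tz, if_pos h, ← mul_assoc, mul_div_assoc, ← add_mul]
    gcongr

end Aux

/-- Asymptotic log-concavity in the bulk:
`T(n,kₙ(x))² / (T(n,kₙ(x+y))·T(n,kₙ(x−y))) → exp(y²)` as `n → ∞`. -/
theorem asymptotic_log_concavity (x y : ℝ) :
    Filter.Tendsto
      (fun n : ℕ => ((Tz n (kIdx n x) : ℝ)) ^ 2 /
        ((Tz n (kIdx n (x + y)) : ℝ) * (Tz n (kIdx n (x - y)) : ℝ)))
      Filter.atTop (nhds (Real.exp (y ^ 2))) := by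
  have h0 := T_asymp x
  have h1 := T_asymp (x + y)
  have h2 := T_asymp (x - y)
  have hpi := Real.pi_pos
  have h := (h0.pow 2).div (h1.mul h2) (by positivity)
  have e : (√(2/Real.pi) * Real.exp (-(x^2/2)))^2 / ((√(2/Real.pi) * Real.exp (-((x+y)^2/2))) * (√(2/Real.pi) * Real.exp (-((x-y)^2/2)))) = Real.exp (y^2) := by
    have hs : 0 < √(2/Real.pi) := by positivity
    rw [div_eq_iff (by positivity)]
    have : Real.exp (-(x^2/2))^2 = Real.exp (y^2) * (Real.exp (-((x+y)^2/2)) * Real.exp (-((x-y)^2/2))) := by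
      rw [← Real.exp_add, ← Real.exp_add, ← Real.exp_nat_mul]
      congr 1
      push_cast
      ring
    rw [mul_pow, this]
    ring
  rw [e] at h
  refine h.congr ?_
  intro n
  have hp : (0:ℝ) < n.factorial := by positivity
  have hc : 0 < ((n.factorial : ℝ) ^ 2 * (√(n.factorial : ℝ) / 2 ^ n.factorial)) := by positivity
  simp only [Pi.div_apply]
  rw [mul_pow, mul_mul_mul_comm, ← pow_two ((n.factorial : ℝ) ^ 2 * (√(n.factorial : ℝ) / 2 ^ n.factorial))]
  exact mul_div_mul_right _ _ (by positivity)
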